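/- For every integer p ≥ 1 there exist nonzero elements a', b' of Λ₄ such that Ψ_{S'}^{2p} = a'·1 + b'·(u₁·w₄) in Q. (In the paper's language: Ψ_{S'}^{2p} lies in the Λ-span of (11 1̄1̄) and (01 1̄0̄), with both coordinates nonvanishing.) -/

import Mathlib

/- Λ₄ is the group algebra of ℝ⁴ over ℝ; `E β` is the Novikov monomial e^β,
   δ i the standard basis vectors of ℝ⁴.  `Q` is the Künneth model of the
   quantum homology of M = (S²×S²)×(S²×S²) with form (ω₀⊕λω₀)⊕(−ω₀⊕−λω₀):
   the quotient of Λ₄[U₁,U₂,U₃,U₄] by U₁²−e^{−δ₁}, U₂²−e^{−δ₂}, U₃²−e^{δ₃},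
   U₄²−e^{δ₄}; `u i` are the images of the variables (u₁,u₂,w₃,w₄). -/

noncomputable section

abbrev Λ₄ : Type := AddMonoidAlgebra ℝ (Fin 4 → ℝ)

def E (β : Fin 4 → ℝ) : Λ₄ := AddMonoidAlgebra.single β 1

def δ (i : Fin 4) : Fin 4 → ℝ := Pi.single i 1

def qRel : Ideal (MvPolynomial (Fin 4) Λ₄) :=
  Ideal.span {MvPolynomial.X 0 ^ 2 - MvPolynomial.C (E (-δ 0)),
              MvPolynomial.X 1 ^ 2 - MvPolynomial.C (E (-δ 1)),
              MvPolynomial.X 2 ^ 2 - MvPolynomial.C (E (δ 2)),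
              MvPolynomial.X 3 ^ 2 - MvPolynomial.C (E (δ 3))}

abbrev Q : Type := MvPolynomial (Fin 4) Λ₄ ⧸ qRel

def u (i : Fin 4) : Q := Ideal.Quotient.mk qRel (MvPolynomial.X i)

def eQ (β : Fin 4 → ℝ) : Q := algebraMap Λ₄ Q (E β)

/-- Ψ_S = (u₁+u₂)·e^{(1/2+h)δ₁−hδ₂} -/
def ΨS (h : ℝ) : Q := (u 0 + u 1) * eQ ((1 / 2 + h) • δ 0 - h • δ 1)

/-- Ψ_T = −(w₃+w₄)·e^{−(1/2+h)δ₃+hδ₄} -/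
def ΨT (h : ℝ) : Q := -((u 2 + u 3) * eQ (-((1 / 2 + h) • δ 2) + h • δ 3))

/-- Ψ_{S'} = (u₁−w₄)·e^{(1/2+h)δ₁+hδ₄} -/
def ΨS' (h : ℝ) : Q := (u 0 - u 3) * eQ ((1 / 2 + h) • δ 0 + h • δ 3)

/-- Ψ_{T'} = (u₂−w₃)·e^{−(1/2+h)δ₃−hδ₂} -/
def ΨT' (h : ℝ) : Q := (u 1 - u 2) * eQ (-((1 / 2 + h) • δ 2) - h • δ 1)

/-- The augmentation of the group algebra, sending every monomial `E β` to `1`. -/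
def augmentation : Λ₄ →ₐ[ℝ] ℝ := AddMonoidAlgebra.lift ℝ ℝ (Fin 4 → ℝ) 1

lemma augmentation_E (β : Fin 4 → ℝ) : augmentation (E β) = 1 := by
  simp [augmentation, E]

lemma u_zero_sq : u 0 ^ 2 = eQ (-δ 0) :=
  Ideal.Quotient.eq.mpr (Ideal.subset_span (by simp))

lemma u_three_sq : u 3 ^ 2 = eQ (δ 3) :=
  Ideal.Quotient.eq.mpr (Ideal.subset_span (by simp))

/-- Even powers of `ΨS' h` have coordinates with augmentations of opposite strict signs. -/
lemma exists_coords_ΨS'_pow (h : ℝ) (n : ℕ) :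
    ∃ a b : Λ₄, 0 < augmentation a ∧ augmentation b < 0 ∧
      ΨS' h ^ (2 * (n + 1)) = algebraMap Λ₄ Q a + algebraMap Λ₄ Q b * (u 0 * u 3) := by
  have h0 := u_zero_sq
  have h3 := u_three_sq
  unfold eQ at h0 h3
  unfold ΨS' eQ
  generalize (1 / 2 + h) • δ 0 + h • δ 3 = θ
  induction n with
  | zero =>
    refine ⟨E θ ^ 2 * (E (-δ 0) + E (δ 3)), -(E θ ^ 2 * 2), ?_, ?_, ?_⟩
    · simp only [map_add, map_mul, map_pow, augmentation_E]
      norm_num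
    · simp only [map_neg, map_mul, map_pow, map_ofNat, augmentation_E]
      norm_num
    · simp only [map_add, map_mul, map_neg, map_pow, map_ofNat, ← h0, ← h3]
      ring
  | succ n ih =>
    obtain ⟨a, b, ha, hb, hab⟩ := ih
    refine ⟨E θ ^ 2 * ((E (-δ 0) + E (δ 3)) * a - 2 * (E (-δ 0) * E (δ 3)) * b),
      E θ ^ 2 * ((E (-δ 0) + E (δ 3)) * b - 2 * a), ?_, ?_, ?_⟩
    · simp only [map_add, map_sub, map_mul, map_pow, map_ofNat, augmentation_E]
      linarith
    · simp only [map_add, map_sub, map_mul, map_pow, map_ofNat, augmentation_E]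
      linarith
    · rw [show 2 * (n + 1 + 1) = 2 * (n + 1) + 2 by ring, pow_add, hab]
      simp only [map_add, map_sub, map_mul, map_pow, map_ofNat, ← h0, ← h3]
      ring

/-- For every p ≥ 1, Ψ_{S'}^{2p} = a'·1 + b'·(u₁·w₄) in Q with a', b' nonzero in Λ₄. -/
theorem psiS'_even_powers_two_nonzero_coords
    (lam : ℝ) (hlam : 1 < lam) (h : ℝ) (hh : h = 1 / (6 * lam * (lam - 1)))
    (p : ℕ) (hp : 1 ≤ p) :
    ∃ a' b' : Λ₄, a' ≠ 0 ∧ b' ≠ 0 ∧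
      ΨS' h ^ (2 * p) = algebraMap Λ₄ Q a' * 1 + algebraMap Λ₄ Q b' * (u 0 * u 3) := by
  obtain ⟨n, rfl⟩ := Nat.exists_eq_add_of_le' hp
  obtain ⟨a, b, ha, hb, hab⟩ := exists_coords_ΨS'_pow h n
  refine ⟨a, b, ?_, ?_, by rw [hab, mul_one]⟩
  · rintro rfl
    simp at ha
  · rintro rfl
    simp at hb

end
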